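/- Let S := Σ a : A, Set (B a). The algebra of hereditarily small sets — the type {x : ZFSet // x is hereditarily small relative to B} with algebra map sending ⟨a, f⟩ to the ZF set whose elements are exactly the (underlying) values of f — satisfies every image-preserving equation with variable type S, and it is initial among such algebras: for every algebra (X, t) for the polynomial (A, B) satisfying every image-preserving equation with variable type S, there exists exactly one homomorphism from the algebra of hereditarily small sets to (X, t). -/

import Mathlib

universe u v w

/-- A ZF set `x` is hereditarily small relative to the family `B : A → Type u`
if `x` is small relative to `B` (some `f : B a → ZFSet` enumerates exactly the
elements of `x`) and every element of `x` is hereditarily small relative to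
`B`.  (Since `∈` is well founded on `ZFSet`, this inductive predicate is
exactly the predicate defined by `∈`-recursion.) -/
inductive HereditarilySmall {A : Type v} (B : A → Type u) : ZFSet.{u} → Prop
  | intro (x : ZFSet.{u})
      (small : ∃ (a : A) (f : B a → ZFSet.{u}), ∀ y, y ∈ x ↔ ∃ b, f b = y)
      (hered : ∀ y ∈ x, HereditarilySmall B y) : HereditarilySmall B x

/-- The set whose elements are exactly the underlying values of a family of
hereditarily small sets is again hereditarily small. -/
theorem hereditarilySmall_range {A : Type v} {B : A → Type u} (a : A)
    (f : B a → {x : ZFSet.{u} // HereditarilySmall B x}) :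
    HereditarilySmall B (ZFSet.range fun b => (f b).1) := by
  refine .intro _ ⟨a, fun b => (f b).1, fun y => ?_⟩ ?_
  · simp [ZFSet.mem_range]
  · intro y hy
    rw [ZFSet.mem_range] at hy
    obtain ⟨b, rfl⟩ := hy
    exact (f b).2

/-- The algebra structure on the hereditarily small sets: `⟨a, f⟩` is sent to
the ZF set whose elements are exactly the underlying values of `f`. -/
noncomputable def hsAlg {A : Type v} {B : A → Type u}
    (p : Σ a : A, (B a → {x : ZFSet.{u} // HereditarilySmall B x})) :
    {x : ZFSet.{u} // HereditarilySmall B x} :=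
  ⟨ZFSet.range fun b => (p.2 b).1, hereditarilySmall_range p.1 p.2⟩

/-- Two values of the algebra map on hereditarily small sets agree exactly when the two
families have the same range. -/
theorem hsAlg_eq_hsAlg_iff {A : Type v} {B : A → Type u} {a b : A}
    {f : B a → {x : ZFSet.{u} // HereditarilySmall B x}}
    {g : B b → {x : ZFSet.{u} // HereditarilySmall B x}} :
    hsAlg ⟨a, f⟩ = hsAlg ⟨b, g⟩ ↔ Set.range f = Set.range g := by
  have mem {c : A} (k : B c → {x : ZFSet.{u} // HereditarilySmall B x}) (z) :
      z.1 ∈ (hsAlg ⟨c, k⟩).1 ↔ z ∈ Set.range k := by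
    simp [hsAlg, Subtype.ext_iff]
  constructor
  · intro h
    ext z
    rw [← mem, ← mem, h]
  · intro h
    refine Subtype.ext (ZFSet.ext fun z => ?_)
    by_cases hz : HereditarilySmall B z
    · rw [mem f ⟨z, hz⟩, mem g ⟨z, hz⟩, h]
    · constructor <;> intro hm <;> obtain ⟨i, rfl⟩ := ZFSet.mem_range.1 hm <;>
        exact absurd (Subtype.prop _) hz

/-- The members of a family are elements of its image under the algebra map. -/
theorem mem_hsAlg {A : Type v} {B : A → Type u} {a : A}
    (f : B a → {x : ZFSet.{u} // HereditarilySmall B x}) (i : B a) :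
    (f i).1 ∈ (hsAlg ⟨a, f⟩).1 :=
  ZFSet.mem_range.2 ⟨i, rfl⟩

/-- Every hereditarily small set is in the image of the algebra map. -/
theorem hsAlg_surjective {A : Type v} {B : A → Type u} :
    Function.Surjective (hsAlg (B := B)) := by
  rintro ⟨x, hx⟩
  obtain ⟨_, ⟨a, f, hf⟩, hered⟩ := hx
  refine ⟨⟨a, fun i => ⟨f i, hered _ ((hf _).2 ⟨i, rfl⟩)⟩⟩, Subtype.ext (ZFSet.ext fun y => ?_)⟩
  rw [hf y]
  exact ZFSet.mem_range

/-- Membership is well founded on the hereditarily small sets. -/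
theorem hereditarilySmall_mem_wellFounded {A : Type v} (B : A → Type u) :
    WellFounded fun x y : {x : ZFSet.{u} // HereditarilySmall B x} => x.1 ∈ y.1 :=
  InvImage.wf Subtype.val ZFSet.mem_wf

/-- In an algebra satisfying all image-preserving equations with variable type
`Σ c : A, Set (B c)`, the algebra map depends only on the range of a family: elements of the range
of `f` can be named by their fibres under `f`. -/
theorem algebra_eq_of_range_eq {A : Type v} {B : A → Type u} {X : Type w}
    {t : (Σ a : A, (B a → X)) → X}
    (ht : ∀ (a b : A) (l : B a → Σ c : A, Set (B c)) (r : B b → Σ c : A, Set (B c)),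
      Set.range l = Set.range r →
      ∀ h : (Σ c : A, Set (B c)) → X, t ⟨a, h ∘ l⟩ = t ⟨b, h ∘ r⟩)
    {a b : A} {f : B a → X} {g : B b → X} (hfg : Set.range f = Set.range g) :
    t ⟨a, f⟩ = t ⟨b, g⟩ := by
  let n : X → Σ c : A, Set (B c) := fun x => ⟨a, f ⁻¹' {x}⟩
  have hn : Set.InjOn n (Set.range f) := by
    rintro _ ⟨i, rfl⟩ y _ hxy
    have hfib : f ⁻¹' {f i} = f ⁻¹' {y} := eq_of_heq (Sigma.mk.inj hxy).2
    exact (Set.ext_iff.1 hfib i).1 rfl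
  have : Nonempty X := ⟨t ⟨a, f⟩⟩
  have hinv := hn.leftInvOn_invFunOn
  have key := ht a b (n ∘ f) (n ∘ g) (by rw [Set.range_comp, Set.range_comp, hfg])
    (Function.invFunOn n (Set.range f))
  have hf : Function.invFunOn n (Set.range f) ∘ n ∘ f = f :=
    funext fun i => hinv ⟨i, rfl⟩
  have hg : Function.invFunOn n (Set.range f) ∘ n ∘ g = g :=
    funext fun i => hinv (hfg ▸ ⟨i, rfl⟩)
  rwa [hf, hg] at key

/-- For any algebra, some function from the hereditarily small sets commutes with the algebra maps
on one presentation of each hereditarily small set. -/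
theorem exists_hereditarilySmall_rec {A : Type v} {B : A → Type u} {X : Type w}
    (t : (Σ a : A, (B a → X)) → X) :
    ∃ h : {x : ZFSet.{u} // HereditarilySmall B x} → X, ∀ x,
      ∃ (a : A) (f : B a → {x : ZFSet.{u} // HereditarilySmall B x}),
        hsAlg ⟨a, f⟩ = x ∧ h x = t ⟨a, h ∘ f⟩ := by
  choose p hp using hsAlg_surjective (B := B)
  have hmem (x) (i : B (p x).1) : ((p x).2 i).1 ∈ x.1 :=
    (congrArg Subtype.val (hp x)).subst (motive := fun z => ((p x).2 i).1 ∈ z)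
      (mem_hsAlg (p x).2 i)
  have wf := hereditarilySmall_mem_wellFounded B
  refine ⟨wf.fix fun x ih => t ⟨(p x).1, fun i => ih ((p x).2 i) (hmem x i)⟩,
    fun x => ⟨(p x).1, (p x).2, hp x, ?_⟩⟩
  rw [wf.fix_eq]
  rfl

/-- The algebra of hereditarily small sets satisfies every image-preserving
equation with variable type `S := Σ a : A, Set (B a)`, and it is initial among
such algebras: every algebra `(X, t)` satisfying all image-preserving
equations with variable type `S` admits exactly one homomorphism from it. -/
theorem hereditarilySmall_initial (A : Type v) (B : A → Type u) :
    (∀ (a b : A) (l : B a → Σ c : A, Set (B c)) (r : B b → Σ c : A, Set (B c)),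
      Set.range l = Set.range r →
      ∀ h : (Σ c : A, Set (B c)) → {x : ZFSet.{u} // HereditarilySmall B x},
        hsAlg ⟨a, h ∘ l⟩ = hsAlg ⟨b, h ∘ r⟩) ∧
    (∀ (X : Type w) (t : (Σ a : A, (B a → X)) → X),
      (∀ (a b : A) (l : B a → Σ c : A, Set (B c)) (r : B b → Σ c : A, Set (B c)),
        Set.range l = Set.range r →
        ∀ h : (Σ c : A, Set (B c)) → X, t ⟨a, h ∘ l⟩ = t ⟨b, h ∘ r⟩) →
      ∃! h : {x : ZFSet.{u} // HereditarilySmall B x} → X,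
        ∀ (a : A) (f : B a → {x : ZFSet.{u} // HereditarilySmall B x}),
          h (hsAlg ⟨a, f⟩) = t ⟨a, h ∘ f⟩) := by
  constructor
  · intro a b l r hlr h
    rw [hsAlg_eq_hsAlg_iff, Set.range_comp, Set.range_comp, hlr]
  · intro X t ht
    obtain ⟨h, hh⟩ := exists_hereditarilySmall_rec t
    refine ⟨h, fun a f => ?_, fun k hk => funext fun x => ?_⟩
    · obtain ⟨b, g, hg, heq⟩ := hh (hsAlg ⟨a, f⟩)
      rw [heq]
      apply algebra_eq_of_range_eq ht
      rw [Set.range_comp, Set.range_comp, hsAlg_eq_hsAlg_iff.1 hg]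
    · induction x using (hereditarilySmall_mem_wellFounded B).induction with
      | _ x ih =>
        obtain ⟨a, f, rfl, heq⟩ := hh x
        rw [heq, hk a f]
        have hkf : k ∘ f = h ∘ f := funext fun i => ih (f i) (mem_hsAlg f i)
        rw [hkf]
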